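/- arXiv:1802.07865 — 2 statements merged into one kernel-verified Lean document; each statement's English description precedes it below -/
import Mathlib

section
/- Let x|θ be superconformal coordinates near a Ramond puncture ℱ_k = {x = 0} (i.e. the distribution 𝒟 is generated by D*_θ = ∂_θ + xθ∂_x). Any superconformal change of coordinates z|ζ (one with ℱ_k = {z = 0} and D*_ζ proportional to D*_θ) can be written z = f(x) + λ(x)θ, ζ = ψ(x) + g(x)θ with f, g even and ψ, λ odd, and then necessarily: (1) g(0)² = 1, and (2) λ'(0)ψ(0) = 0. -/
/-!
STATEMENT 11 (Lemma A.1 of the paper).  Let `x|θ` be superconformal coordinates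
near a Ramond puncture `ℱ_k = {x = 0}` (i.e. the distribution `𝒟` is generated by
`D*_θ = ∂_θ + xθ∂_x`; equivalently `𝒟^{−2}(−ℱ)` is generated by
`ϖ*_θ = dx − xθdθ`).  Any superconformal change of coordinates `z|ζ` (one with
`ℱ_k = {z = 0}` and `D*_ζ` proportional to `D*_θ`, equivalently `ϖ*_ζ` an
`O_X`-multiple of `ϖ*_θ`) can be written `z = f(x) + λ(x)θ`, `ζ = ψ(x) + g(x)θ`
with `f, g` even and `ψ, λ` odd, and then necessarily:
(1) `g(0)² = 1`, and (2) `λ'(0)ψ(0) = 0`.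

The model of the function ring and of superfunctions is as in the formalization of
Statement 12.  Here `f(0) = 0` (both `x` and `z` cut out `ℱ_k`) and `f'(0)` is
invertible (the change of coordinates is invertible).
-/

/-- A supercommutative model of the ring of (germs of) holomorphic functions of
the even coordinate `x` near a Ramond puncture `{x = 0}`. -/
structure OddFunctionRing (R : Type) [Ring R] where
  /-- projection onto the even part -/
  E : R →+ R
  /-- projection onto the odd part -/
  O : R →+ R
  decomp : ∀ r, E r + O r = r
  E_idem : ∀ r, E (E r) = E r
  O_idem : ∀ r, O (O r) = O r
  E_O : ∀ r, E (O r) = 0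
  O_E : ∀ r, O (E r) = 0
  /-- the grading is multiplicative (even part of a product) -/
  E_mul : ∀ r s, E (r * s) = E r * E s + O r * O s
  /-- the grading is multiplicative (odd part of a product) -/
  O_mul : ∀ r s, O (r * s) = E r * O s + O r * E s
  /-- supercommutativity: odd functions anticommute -/
  odd_anticomm : ∀ r s, O r * O s = -(O s * O r)
  /-- odd functions square to zero -/
  odd_sq : ∀ r, O r * O r = 0
  /-- supercommutativity: even functions are central -/
  even_comm : ∀ r s, E r * s = s * E r
  /-- the even coordinate function `x` -/
  x : R
  x_even : O x = 0
  /-- the differentiation `d/dx` -/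
  d : R →+ R
  d_mul : ∀ r s, d (r * s) = d r * s + r * d s
  d_x : d x = 1
  d_parity : ∀ r, d (E r) = E (d r)
  /-- evaluation at `x = 0` (onto the constants) -/
  ev0 : R →+* R
  ev0_x : ev0 x = 0

namespace OddFunctionRing

variable {R : Type} [Ring R] (C : OddFunctionRing R)

/-- The grading involution `σ = E − O`, used to commute `θ` past a function:
`θ·r = σ(r)·θ`. -/
def sigma (r : R) : R := C.E r - C.O r

/-- Superfunctions of the superconformal coordinates `x|θ`: `(u, v)` stands for
`u(x) + v(x)θ`; since `θ² = 0` and `θ·r = σ(r)·θ`, the product is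
`(u₁ + v₁θ)(u₂ + v₂θ) = u₁u₂ + (u₁v₂ + v₁σ(u₂))θ`. -/
def smul2 (F G : R × R) : R × R := (F.1 * G.1, F.1 * G.2 + F.2 * C.sigma G.1)

/-- `∂/∂x` on superfunctions. -/
def dx (F : R × R) : R × R := (C.d F.1, C.d F.2)

/-- `∂/∂θ` on superfunctions: `∂θ(u + vθ) = v`. -/
def dtheta (F : R × R) : R × R := (F.2, 0)

/-- The superconformality condition on the coordinate change `(z|ζ)` near the
Ramond puncture `{x = 0}`: `ϖ*_ζ = dz − zζdζ` is an `O_X`-multiple of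
`ϖ*_θ = dx − xθdθ`, which unwinds to
`−(∂z/∂x − zζ ∂ζ/∂x)·x·θ = ∂z/∂θ − zζ ∂ζ/∂θ`
(here `x·θ` is the superfunction `(0, x)`). -/
def Superconformal (z ζ : R × R) : Prop :=
  -(C.smul2 (C.dx z - C.smul2 (C.smul2 z ζ) (C.dx ζ)) (0, C.x)) =
    OddFunctionRing.dtheta z - C.smul2 (C.smul2 z ζ) (OddFunctionRing.dtheta ζ)

end OddFunctionRing

/-- Lemma A.1: for a superconformal change of coordinates `z = f(x) + λ(x)θ`,
`ζ = ψ(x) + g(x)θ` (`f, g` even, `λ, ψ` odd) near a Ramond puncture — so that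
`f(0) = 0`, `f'(0)` is invertible, and the superconformality condition holds —
one has (1) `g(0)² = 1` and (2) `λ'(0)ψ(0) = 0`. -/
theorem superconformal_change_constraints (R : Type) [Ring R]
    (C : OddFunctionRing R) (f g ψ lam : R)
    (hf : C.O f = 0) (hg : C.O g = 0) (hψ : C.E ψ = 0) (hlam : C.E lam = 0)
    (hf0 : C.ev0 f = 0)
    (hf1 : IsUnit (C.ev0 (C.d f)))
    (hsc : C.Superconformal (f, lam) (ψ, g)) :
    C.ev0 g * C.ev0 g = 1 ∧ C.ev0 (C.d lam) * C.ev0 ψ = 0 := by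
  have hψO : C.O ψ = ψ := by
    have h := C.decomp ψ
    rwa [hψ, zero_add] at h
  have hgE : C.E g = g := by
    have h := C.decomp g
    rwa [hg, add_zero] at h
  have hψψ : ψ * ψ = 0 := by
    have h := C.odd_sq ψ
    rwa [hψO] at h
  have hgc : ∀ s, g * s = s * g := by
    intro s
    have h := C.even_comm g s
    rwa [hgE] at h
  have hψgψ : ψ * g * ψ = 0 := by
    rw [mul_assoc, hgc, ← mul_assoc, hψψ, zero_mul]
  have h1 := congrArg Prod.fst hsc
  have h2 := congrArg Prod.snd hsc
  simp only [OddFunctionRing.smul2, OddFunctionRing.dx, OddFunctionRing.dtheta,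
    OddFunctionRing.sigma, Prod.fst_sub, Prod.snd_sub, Prod.fst_neg, Prod.snd_neg,
    map_zero, sub_zero, mul_zero, add_zero, zero_add, neg_zero, zero_sub, neg_inj,
    hψ, hψO, hg, hgE] at h1 h2
  have hl : lam = f * ψ * g := (sub_eq_zero.mp h1.symm)
  have hlψ : lam * ψ = 0 := by
    rw [hl, mul_assoc f, mul_assoc, hψgψ, mul_zero]
  rw [mul_neg, hlψ, neg_zero, add_zero] at h2
  have h3 := congrArg C.ev0 (congrArg C.d h2)
  simp only [C.d_mul, C.d_x, map_add, map_mul, map_sub, map_one, C.ev0_x, hf0, mul_zero,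
    zero_mul, add_zero, zero_add, sub_zero, mul_one] at h3
  have h4 := congrArg C.ev0 (congrArg C.d hl)
  simp only [C.d_mul, map_add, map_mul, hf0, zero_mul, add_zero] at h4
  refine ⟨?_, ?_⟩
  · apply hf1.mul_left_cancel
    rw [mul_one, ← mul_assoc]
    exact h3.symm
  · have h5 := congrArg C.ev0 hψgψ
    simp only [map_mul, map_zero] at h5
    rw [h4, mul_assoc (C.ev0 (C.d f)), mul_assoc, h5, mul_zero]
end

section
/- The superconformality of a coordinate change z = f(x) + λ(x)θ, ζ = ψ(x) + g(x)θ near a Ramond puncture (the condition that ϖ*_ζ = dz − zζdζ be proportional to ϖ*_θ = dx − xθdθ) is equivalent to the pair of equations: λ(x) − f(x)g(x)ψ(x) = 0 and f(x)g(x)² + λ(x)ψ(x)g(x) = x f'(x) − x f(x)ψ(x)ψ'(x). In particular the first equation forces λ(x)ψ(x) = 0, so the second becomes f(x)g(x)² = x f'(x) − x f(x)ψ(x)ψ'(x). -/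
/-- for a coordinate change `z = f(x) + λ(x)θ`, `ζ = ψ(x) + g(x)θ`
(`f, g` even, `λ, ψ` odd, `f(0) = 0`) near a Ramond puncture, superconformality is
equivalent to the pair of equations
`λ − fgψ = 0` and `fg² + λψg = x f' − x f ψ ψ'`; and it forces `λψ = 0`, so that
the second equation becomes `fg² = x f' − x f ψ ψ'`. -/
theorem superconformality_equations (R : Type) [Ring R] (C : OddFunctionRing R)
    (f g ψ lam : R)
    (hf : C.O f = 0) (hg : C.O g = 0) (hψ : C.E ψ = 0) (hlam : C.E lam = 0)
    (hf0 : C.ev0 f = 0) :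
    (C.Superconformal (f, lam) (ψ, g) ↔
      (lam - f * g * ψ = 0 ∧
        f * g ^ 2 + lam * ψ * g = C.x * C.d f - C.x * f * ψ * C.d ψ)) ∧
    (C.Superconformal (f, lam) (ψ, g) →
      (lam * ψ = 0 ∧ f * g ^ 2 = C.x * C.d f - C.x * f * ψ * C.d ψ)) := by
  have hgE : C.E g = g := by have h := C.decomp g; rwa [hg, add_zero] at h
  have hxE : C.E C.x = C.x := by have h := C.decomp C.x; rwa [C.x_even, add_zero] at h
  have hψO : C.O ψ = ψ := by have h := C.decomp ψ; rwa [hψ, zero_add] at h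
  have hgc : ∀ s, g * s = s * g := fun s => by
    have h := C.even_comm g s
    rwa [hgE] at h
  have hxc : ∀ s, C.x * s = s * C.x := fun s => by
    have h := C.even_comm C.x s
    rwa [hxE] at h
  have hψψ : ψ * ψ = 0 := by
    have h := C.odd_sq ψ
    rwa [hψO] at h
  have hzero : lam - f * g * ψ = 0 → lam * ψ = 0 := fun h => by
    rw [sub_eq_zero.mp h, mul_assoc, hψψ, mul_zero]
  have e1 : f * ψ * g = f * g * ψ := by rw [mul_assoc, ← hgc ψ, mul_assoc]
  have e2 : (C.d f - f * ψ * C.d ψ) * C.x = C.x * C.d f - C.x * f * ψ * C.d ψ := by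
    rw [← hxc, mul_sub]
    simp only [mul_assoc]
  have key : C.Superconformal (f, lam) (ψ, g) ↔
      (lam - f * g * ψ = 0 ∧
        (f * g - lam * ψ) * g = C.x * C.d f - C.x * f * ψ * C.d ψ) := by
    unfold OddFunctionRing.Superconformal
    simp only [OddFunctionRing.smul2, OddFunctionRing.dx, OddFunctionRing.dtheta,
      OddFunctionRing.sigma, Prod.ext_iff, Prod.fst_sub, Prod.snd_sub, Prod.fst_neg,
      Prod.snd_neg, hg, hgE, hψ, hψO, map_zero, mul_zero, sub_zero, zero_sub, neg_zero,
      add_zero, zero_add, mul_neg, e1, e2, ← sub_eq_add_neg, neg_inj]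
    exact and_congr eq_comm eq_comm
  have main : C.Superconformal (f, lam) (ψ, g) →
      (lam * ψ = 0 ∧ f * g ^ 2 = C.x * C.d f - C.x * f * ψ * C.d ψ) := fun h => by
    obtain ⟨h1, h2⟩ := key.mp h
    have h0 := hzero h1
    refine ⟨h0, ?_⟩
    rwa [h0, sub_zero, mul_assoc, ← pow_two] at h2
  refine ⟨⟨fun h => ?_, fun h => ?_⟩, main⟩
  · obtain ⟨h0, h2⟩ := main h
    refine ⟨(key.mp h).1, ?_⟩
    rw [h0, zero_mul, add_zero, h2]
  · obtain ⟨h1, h2⟩ := h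
    have h0 := hzero h1
    refine key.mpr ⟨h1, ?_⟩
    rw [h0, zero_mul, add_zero] at h2
    rw [h0, sub_zero, mul_assoc, ← pow_two, h2]
end
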